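/- arXiv:1704.01877 — 2 statements merged into one kernel-verified Lean document; each statement's English description precedes it below -/
import Mathlib

section
/- Let (X,d) be a metric space and let F : X → K(X) be a continuous multivalued map with compact values, inducing the continuous operator F : K(X) → K(X), F(B) = ⋃_{x∈B} F(x). If A* ∈ K(X) is an attractor of F, i.e. F(A*) = A* and there exists an open set U ⊆ K(X) containing A* such that d_H(Fⁿ(B), A*) → 0 as n → ∞ for every B ∈ U, then A* is an asymptotically stable fixed point of the operator F in (K(X), d_H): in addition to the attractivity, for every ε > 0 there exists δ > 0 such that d_H(Fⁿ(B), A*) < ε for all n ∈ ℕ and all B ∈ K(X) with d_H(B, A*) < δ. -/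
open TopologicalSpace Metric Filter

namespace TopologicalSpace.NonemptyCompacts

variable {X : Type*} [MetricSpace X]

theorem dist_le_of_forall_exists {K L : NonemptyCompacts X} {r : ℝ} (hr : 0 ≤ r)
    (hKL : ∀ x ∈ K, ∃ y ∈ L, dist x y ≤ r) (hLK : ∀ y ∈ L, ∃ x ∈ K, dist y x ≤ r) :
    dist K L ≤ r :=
  hausdorffDist_le_of_mem_dist hr hKL hLK

theorem exists_dist_lt_of_dist_lt {K L : NonemptyCompacts X} {r : ℝ} (h : dist K L < r)
    {x : X} (hx : x ∈ K) : ∃ y ∈ L, dist x y < r :=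
  exists_dist_lt_of_hausdorffDist_lt hx h
    (hausdorffEDist_ne_top_of_nonempty_of_bounded K.nonempty L.nonempty K.isCompact.isBounded
      L.isCompact.isBounded)

/-- If `L` lies in the closed `r`-neighbourhood of `K`, then some compact subset of `K` is at
distance at most `r` from `L`. -/
theorem exists_le_dist_le {K L : NonemptyCompacts X} {r : ℝ} (hr : 0 ≤ r)
    (h : ∀ y ∈ L, ∃ x ∈ K, dist y x ≤ r) : ∃ D ≤ K, dist D L ≤ r := by
  have hmem : ∀ y ∈ L, ∃ x ∈ (K : Set X) ∩ cthickening r (L : Set X), dist y x ≤ r := by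
    intro y hy
    obtain ⟨x, hx, hyx⟩ := h y hy
    exact ⟨x, ⟨hx, mem_cthickening_of_dist_le x y r _ hy (by rwa [dist_comm])⟩, hyx⟩
  obtain ⟨y₀, hy₀⟩ := L.nonempty
  obtain ⟨x₀, hx₀, -⟩ := hmem y₀ hy₀
  refine ⟨⟨⟨_, K.isCompact.inter_right isClosed_cthickening⟩, ⟨x₀, hx₀⟩⟩,
    fun x hx => hx.1, dist_le_of_forall_exists hr ?_ hmem⟩
  intro x hx
  have hx' : x ∈ cthickening r (L : Set X) := hx.2
  rw [L.isCompact.cthickening_eq_biUnion_closedBall hr] at hx'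
  simpa using hx'

/-- A compact subset of `A` containing `D` approximates `A` at least as well as `D` does. -/
theorem dist_le_dist_of_le_of_le {D E A : NonemptyCompacts X} (hDE : D ≤ E) (hEA : E ≤ A) {r : ℝ}
    (h : dist D A < r) : dist E A ≤ r := by
  have hr : 0 ≤ r := dist_nonneg.trans h.le
  refine dist_le_of_forall_exists hr (fun x hx => ⟨x, hEA hx, by simpa using hr⟩) fun y hy => ?_
  obtain ⟨x, hx, hxy⟩ := exists_dist_lt_of_dist_lt (dist_comm D A ▸ h) hy
  exact ⟨x, hDE hx, hxy.le⟩

/-- The compact set `A ∪ ⋃ k, B k`, for a sequence `B` of compact sets converging to `A`. -/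
theorem exists_coe_eq_union_iUnion {A : NonemptyCompacts X} {B : ℕ → NonemptyCompacts X}
    (hB : Tendsto B atTop (nhds A)) :
    ∃ C : NonemptyCompacts X, (C : Set X) = (A : Set X) ∪ ⋃ k, (B k : Set X) := by
  have hC := isCompact_biUnion_coe_of_isCompact hB.isCompact_insert_range
  rw [Set.biUnion_insert, Set.biUnion_range] at hC
  exact ⟨⟨⟨_, hC⟩, A.nonempty.inl⟩, rfl⟩

variable {G : NonemptyCompacts X → NonemptyCompacts X} {A : NonemptyCompacts X} {r : ℝ}

/-- Under a monotone continuous operator attracting a neighbourhood of the fixed point `A`, the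
orbits of all compact sets close to `A` stay in a prescribed neighbourhood of the set `A`. -/
theorem exists_pos_forall_iterate_subset_thickening (hG : Continuous G) (hmono : Monotone G)
    (hfix : G A = A) (hr : 0 < r)
    (hattr : ∀ B, dist B A ≤ r → Tendsto (fun n => G^[n] B) atTop (nhds A)) {η : ℝ} (hη : 0 < η) :
    ∃ δ > 0, ∀ B, dist B A < δ → ∀ n, ∀ x ∈ G^[n] B, ∃ a ∈ A, dist x a < η := by
  by_contra! hcon
  obtain ⟨u, -, hu, hu0⟩ := exists_seq_strictAnti_tendsto' hr
  choose B hBu n x hx hxA using fun k => hcon (u k) (hu k).1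
  have hB : Tendsto B atTop (nhds A) :=
    tendsto_iff_dist_tendsto_zero.2
      (squeeze_zero (fun _ => dist_nonneg) (fun k => (hBu k).le) hu0)
  obtain ⟨C, hC⟩ := exists_coe_eq_union_iUnion hB
  have hAC : A ≤ C := SetLike.coe_subset_coe.1 (hC ▸ Set.subset_union_left)
  have hBC : ∀ k, B k ≤ C := fun k => SetLike.coe_subset_coe.1
    (hC ▸ (Set.subset_iUnion (fun k => (B k : Set X)) k).trans Set.subset_union_right)
  have hCA : dist C A ≤ r := by
    refine dist_le_of_forall_exists hr.le (fun y hy => ?_)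
      fun y hy => ⟨y, hAC hy, by simpa using hr.le⟩
    have hy' : y ∈ (A : Set X) ∪ ⋃ k, (B k : Set X) := hC ▸ hy
    rcases hy' with hyA | hyB
    · exact ⟨y, hyA, by simpa using hr.le⟩
    · obtain ⟨k, hk⟩ := Set.mem_iUnion.1 hyB
      obtain ⟨a, ha, hya⟩ := exists_dist_lt_of_dist_lt ((hBu k).trans (hu k).2) hk
      exact ⟨a, ha, hya.le⟩
  obtain ⟨N, hN⟩ := (tendsto_atTop_nhds.1 (hattr C hCA)) (ball A η) (mem_ball_self hη) isOpen_ball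
  have hlt : ∀ k, n k < N := by
    intro k
    by_contra! hk
    obtain ⟨a, ha, hxa⟩ :=
      exists_dist_lt_of_dist_lt (hN _ hk) (hmono.iterate (n k) (hBC k) (hx k))
    exact (hxA k a ha).not_gt hxa
  have hev : ∀ᶠ k in atTop, ∀ m ∈ Finset.range N, dist (G^[m] (B k)) A < η := by
    rw [Filter.eventually_all_finset]
    intro m _
    have h := ((hG.iterate m).tendsto A).comp hB
    rw [Function.iterate_fixed hfix] at h
    exact h.eventually (ball_mem_nhds A hη)
  obtain ⟨k, hk⟩ := hev.exists
  obtain ⟨a, ha, hxa⟩ := exists_dist_lt_of_dist_lt (hk _ (Finset.mem_range.2 (hlt k))) (hx k)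
  exact (hxA k a ha).not_gt hxa

/-- A monotone continuous operator attracting a neighbourhood of its fixed point `A` attracts
uniformly the compact subsets of `A` which are close to `A`. -/
theorem exists_forall_iterate_dist_le (hG : Continuous G) (hmono : Monotone G)
    (hfix : G A = A) (hr : 0 < r)
    (hattr : ∀ B, dist B A ≤ r → Tendsto (fun n => G^[n] B) atTop (nhds A)) {ε : ℝ} (hε : 0 < ε) :
    ∃ T, ∀ D ≤ A, dist D A ≤ r → ∀ n ≥ T, dist (G^[n] D) A ≤ ε := by
  have hle : ∀ D ≤ A, ∀ n, G^[n] D ≤ A := fun D hD n => by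
    simpa [Function.iterate_fixed hfix] using hmono.iterate n hD
  let Q : Set (NonemptyCompacts X) := {D | (D : Set X) ⊆ A} ∩ closedBall A r
  have hQ : IsCompact Q :=
    (isCompact_subsets_of_isCompact A.isCompact).inter_right isClosed_closedBall
  have : CompactSpace Q := isCompact_iff_compactSpace.1 hQ
  let E : ℕ → Set Q := fun N => {D | ∀ n ≥ N, dist (G^[n] D) A ≤ ε / 2}
  have hEclosed : ∀ N, IsClosed (E N) := fun N => by
    simp only [E, Set.ofPred_forall]
    exact isClosed_iInter fun n => isClosed_iInter fun _ => isClosed_le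
      (((hG.iterate n).comp continuous_subtype_val).dist continuous_const) continuous_const
  have hEunion : ⋃ N, E N = Set.univ := by
    refine Set.eq_univ_of_forall fun D => Set.mem_iUnion.2 ?_
    exact eventually_atTop.1
      ((hattr D D.2.2).eventually (closedBall_mem_nhds A (half_pos hε)))
  obtain ⟨D₀, hD₀r, hD₀⟩ := (dense_iUnion_interior_of_closed hEclosed hEunion).inter_open_nonempty
    {D : Q | dist (D : NonemptyCompacts X) A < r}
    (isOpen_lt (continuous_subtype_val.dist continuous_const) continuous_const)
    ⟨⟨A, Set.Subset.refl (A : Set X), by simpa using hr.le⟩, by simpa using hr⟩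
  obtain ⟨N, hN⟩ := Set.mem_iUnion.1 hD₀
  obtain ⟨ρ, hρ, hρN⟩ := Metric.isOpen_iff.1 isOpen_interior D₀ hN
  have hD₀r' : dist (D₀ : NonemptyCompacts X) A < r := hD₀r
  obtain ⟨σ, hσ, hσρ⟩ := exists_between (lt_min hρ (sub_pos.2 hD₀r'))
  have hσρ' := lt_min_iff.1 hσρ
  have hnear : ∀ D ≤ A, dist D A < σ → ∀ n ≥ N, dist (G^[n] D) A ≤ ε := by
    intro D hDA hD n hn
    obtain ⟨D', hD'D, hD'⟩ : ∃ D' ≤ D, dist D' (D₀ : NonemptyCompacts X) ≤ σ := by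
      refine exists_le_dist_le hσ.le fun y hy => ?_
      obtain ⟨x, hx, hyx⟩ := exists_dist_lt_of_dist_lt (dist_comm D A ▸ hD) (D₀.2.1 hy)
      exact ⟨x, hx, hyx.le⟩
    have hD'Q : D' ∈ Q := ⟨hD'D.trans hDA, by
      have := dist_triangle D' (D₀ : NonemptyCompacts X) A
      rw [mem_closedBall]
      linarith [hσρ'.2]⟩
    have hE : (⟨D', hD'Q⟩ : Q) ∈ E N :=
      interior_subset (hρN (show dist D' (D₀ : NonemptyCompacts X) < ρ from hD'.trans_lt hσρ'.1))
    exact dist_le_dist_of_le_of_le (hmono.iterate n hD'D) (hle D hDA n)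
      ((hE n hn).trans_lt (half_lt_self hε))
  obtain ⟨t, ht⟩ := hQ.elim_finite_subcover (fun m => G^[m] ⁻¹' ball A σ)
    (fun m => isOpen_ball.preimage (hG.iterate m)) fun D hD => Set.mem_iUnion.2
      ((hattr D hD.2).eventually (ball_mem_nhds A hσ)).exists
  refine ⟨t.sup id + N, fun D hDA hD n hn => ?_⟩
  obtain ⟨m, hm, hDm⟩ := Set.mem_iUnion₂.1 (ht (⟨hDA, hD⟩ : D ∈ Q))
  have hmt : m ≤ t.sup id := Finset.le_sup (f := id) hm
  have := hnear _ (hle D hDA m) hDm (n - m) (by omega)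
  rwa [← Function.iterate_add_apply, Nat.sub_add_cancel (by omega)] at this

/-- A fixed point of a monotone continuous operator on compact sets which attracts a neighbourhood
is stable. -/
theorem exists_pos_forall_iterate_dist_lt (hG : Continuous G) (hmono : Monotone G)
    (hfix : G A = A) (hr : 0 < r)
    (hattr : ∀ B, dist B A ≤ r → Tendsto (fun n => G^[n] B) atTop (nhds A)) {ε : ℝ} (hε : 0 < ε)
    (hεr : 2 * ε ≤ r) : ∃ δ > 0, ∀ B, dist B A < δ → ∀ n, dist (G^[n] B) A < ε := by
  obtain ⟨T₀, hT₀⟩ := exists_forall_iterate_dist_le hG hmono hfix hr hattr (half_pos hε)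
  obtain ⟨T, hTT₀, hT⟩ : ∃ T, T₀ ≤ T ∧ 0 < T := ⟨T₀ + 1, by omega, by omega⟩
  let P : Set (NonemptyCompacts X) := {D | (D : Set X) ⊆ A} ∩ closedBall A (2 * ε)
  have hP : IsCompact P :=
    (isCompact_subsets_of_isCompact A.isCompact).inter_right isClosed_closedBall
  obtain ⟨η, hη, hηP⟩ := hP.exists_thickening_subset_open
    (isOpen_ball.preimage (hG.iterate T) : IsOpen (G^[T] ⁻¹' ball A ε)) fun D hD =>
      (hT₀ D hD.1 (hD.2.trans hεr) T hTT₀).trans_lt (half_lt_self hε)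
  obtain ⟨σ, hσ, hσηε⟩ := exists_between (lt_min hη hε)
  obtain ⟨hση, hσε⟩ := lt_min_iff.1 hσηε
  obtain ⟨δ₁, hδ₁, hupper⟩ :=
    exists_pos_forall_iterate_subset_thickening hG hmono hfix hr hattr hσ
  have hev : ∀ᶠ B in nhds A, ∀ m ∈ Finset.range T, dist (G^[m] B) A < ε := by
    rw [Filter.eventually_all_finset]
    intro m _
    have h := (hG.iterate m).tendsto A
    rw [Function.iterate_fixed hfix] at h
    exact h.eventually (ball_mem_nhds A hε)
  obtain ⟨δ₂, hδ₂, hinit⟩ := Metric.eventually_nhds_iff.1 hev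
  refine ⟨min δ₁ δ₂, lt_min hδ₁ hδ₂, fun B hB n => ?_⟩
  obtain ⟨hB₁, hB₂⟩ := lt_min_iff.1 hB
  induction n using Nat.strong_induction_on with
  | _ n ih =>
    rcases lt_or_ge n T with hn | hn
    · exact hinit hB₂ n (Finset.mem_range.2 hn)
    have hlast := ih (n - T) (by omega)
    obtain ⟨D, hDA, hD⟩ := exists_le_dist_le (K := A) (L := G^[n - T] B) hσ.le fun y hy => by
      obtain ⟨a, ha, hya⟩ := hupper B hB₁ (n - T) y hy
      exact ⟨a, ha, hya.le⟩
    have hDP : D ∈ P := ⟨hDA, by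
      have := dist_triangle D (G^[n - T] B) A
      rw [mem_closedBall]
      linarith⟩
    have := hηP (mem_thickening_iff.2 ⟨D, hDP, (dist_comm D _ ▸ hD).trans_lt hση⟩)
    rwa [Set.mem_preimage, ← Function.iterate_add_apply, Nat.add_sub_cancel' hn] at this

end TopologicalSpace.NonemptyCompacts

/-- **Stability of attractors of multivalued maps.**
If `F : X → K(X)` is a continuous multivalued map with compact values on a metric space,
inducing the continuous operator `FK : K(X) → K(X)`, `FK B = ⋃ x ∈ B, F x`, and
`A` is an attractor of `F` (a fixed point of `FK` attracting an open set `U ∋ A` in the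
hyperspace with the Hausdorff metric), then `A` is a stable (hence asymptotically stable)
fixed point of `FK`. -/
theorem attractor_asymptotically_stable
    {X : Type*} [MetricSpace X]
    (F : X → NonemptyCompacts X) (hF : Continuous F)
    (FK : NonemptyCompacts X → NonemptyCompacts X) (hFKcont : Continuous FK)
    (hFK : ∀ B : NonemptyCompacts X, (FK B : Set X) = ⋃ x ∈ (B : Set X), (F x : Set X))
    (A : NonemptyCompacts X) (hfix : FK A = A)
    (U : Set (NonemptyCompacts X)) (hUopen : IsOpen U) (hAU : A ∈ U)
    (hattr : ∀ B ∈ U, Tendsto (fun n => dist (FK^[n] B) A) atTop (nhds 0)) :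
    ∀ ε > 0, ∃ δ > 0, ∀ B : NonemptyCompacts X, dist B A < δ →
      ∀ n : ℕ, dist (FK^[n] B) A < ε := by
  intro ε hε
  have hmono : Monotone FK := fun B C hBC => SetLike.coe_subset_coe.1 (by
    rw [hFK, hFK]
    exact Set.biUnion_subset_biUnion_left hBC)
  obtain ⟨r, hr, hrU⟩ := nhds_basis_closedBall.mem_iff.1 (hUopen.mem_nhds hAU)
  obtain ⟨δ, hδ, h⟩ := NonemptyCompacts.exists_pos_forall_iterate_dist_lt hFKcont hmono hfix hr
    (fun B hB => tendsto_iff_dist_tendsto_zero.2 (hattr B (hrU hB)))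
    (lt_min hε (half_pos hr)) (by linarith [min_le_right ε (r / 2)])
  exact ⟨δ, hδ, fun B hB n => (h B hB n).trans_le (min_le_left _ _)⟩
end

section
/- Let (X,d) be a locally compact, complete metric space and let F : X → K(X) be a continuous multivalued map with compact values whose induced operator F : K(X) → K(X), F(B) = ⋃_{x∈B} F(x), has a strict attractor A* with basin of attraction B(A*) ⊆ X: B(A*) is the maximal open subset of X containing A* such that d_H(Fⁿ(S), A*) → 0 for every nonempty compact S ⊆ B(A*). Then there exists a metric D on K(B(A*)) (the nonempty compact subsets of B(A*)) inducing the same topology as d_H such that F restricted to K(B(A*)) is a contraction with respect to D: for some c ∈ [0,1), D(F(S), F(S')) ≤ c·D(S, S') for all nonempty compact S, S' ⊆ B(A*). -/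
open TopologicalSpace Metric Filter

section Contraction

variable {Y : Type*} [MetricSpace Y]

/-- The truncation of the metric of `Y` in which the closed ball of radius `r` around `a` is
collapsed to a point. -/
noncomputable def collapsedDist (a : Y) (r : ℝ) (x y : Y) : ℝ :=
  min 1 (min (dist x y) (max 0 (dist x a - r) + max 0 (dist y a - r)))

lemma collapsedDist_nonneg (a : Y) (r : ℝ) (x y : Y) : 0 ≤ collapsedDist a r x y := by
  unfold collapsedDist
  positivity

lemma collapsedDist_le_one (a : Y) (r : ℝ) (x y : Y) : collapsedDist a r x y ≤ 1 :=
  min_le_left _ _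

lemma collapsedDist_le_dist (a : Y) (r : ℝ) (x y : Y) : collapsedDist a r x y ≤ dist x y :=
  (min_le_right _ _).trans (min_le_left _ _)

lemma collapsedDist_self (a : Y) (r : ℝ) (x : Y) : collapsedDist a r x x = 0 :=
  le_antisymm ((collapsedDist_le_dist a r x x).trans_eq (dist_self x))
    (collapsedDist_nonneg a r x x)

lemma collapsedDist_comm (a : Y) (r : ℝ) (x y : Y) :
    collapsedDist a r x y = collapsedDist a r y x := by
  simp only [collapsedDist, dist_comm x y, add_comm]

lemma collapsedDist_eq_zero {a : Y} {r : ℝ} {x y : Y} (hx : dist x a ≤ r) (hy : dist y a ≤ r) :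
    collapsedDist a r x y = 0 := by
  simp [collapsedDist, hx, hy]

lemma collapsedDist_triangle (a : Y) (r : ℝ) (x y z : Y) :
    collapsedDist a r x z ≤ collapsedDist a r x y + collapsedDist a r y z := by
  have hxz := dist_triangle x y z
  have hxy : max 0 (dist x a - r) ≤ dist x y + max 0 (dist y a - r) := by
    refine max_le (by positivity) ?_
    linarith [dist_triangle x y a, le_max_right 0 (dist y a - r)]
  have hzy : max 0 (dist z a - r) ≤ dist y z + max 0 (dist y a - r) := by
    refine max_le (by positivity) ?_
    linarith [dist_triangle_left z a y, dist_comm z y, le_max_right 0 (dist y a - r)]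
  have h0 := le_max_left 0 (dist x a - r)
  have h1 := le_max_left 0 (dist y a - r)
  have h2 := le_max_left 0 (dist z a - r)
  have h3 : 0 ≤ dist x y := dist_nonneg
  have h4 : 0 ≤ dist y z := dist_nonneg
  unfold collapsedDist
  rcases min_cases 1 (min (dist x y) (max 0 (dist x a - r) + max 0 (dist y a - r))) with h | h <;>
  rcases min_cases 1 (min (dist y z) (max 0 (dist y a - r) + max 0 (dist z a - r))) with h' | h' <;>
  rcases min_cases (dist x y) (max 0 (dist x a - r) + max 0 (dist y a - r)) with k | k <;>
  rcases min_cases (dist y z) (max 0 (dist y a - r) + max 0 (dist z a - r)) with k' | k' <;>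
  simp only [min_le_iff] <;>
  first
  | (left; linarith)
  | (right; left; linarith)
  | (right; right; linarith)

/-- The pseudometrics whose supremum is made contracting; `N k` is a number of iterates after
which a neighbourhood of `a` has entered the ball of radius `1 / (k + 1)` around `a`. -/
noncomputable def rescaledDist (f : Y → Y) (a : Y) (N : ℕ → ℕ) (p : ℕ × ℕ) (x y : Y) : ℝ :=
  2 ^ p.1 * (1 / 2) ^ (p.2 + N p.2) *
    collapsedDist a (1 / ((p.2 : ℝ) + 1)) (f^[p.1] x) (f^[p.1] y)

lemma rescaledDist_eq_zero {f : Y → Y} {a : Y} {O : Set Y} {N : ℕ → ℕ}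
    (hN : ∀ k, ∀ n ≥ N k, ∀ x ∈ O, dist (f^[n] x) a ≤ 1 / ((k : ℝ) + 1))
    {m : ℕ} {x y : Y} (hx : f^[m] x ∈ O) (hy : f^[m] y ∈ O) {p : ℕ × ℕ} (hp : N p.2 + m ≤ p.1) :
    rescaledDist f a N p x y = 0 := by
  obtain ⟨j, hj, hjm⟩ : ∃ j, N p.2 ≤ j ∧ p.1 = j + m := ⟨p.1 - m, by omega, by omega⟩
  rw [rescaledDist, collapsedDist_eq_zero, mul_zero]
  · rw [hjm, Function.iterate_add_apply]
    exact hN _ _ hj _ hx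
  · rw [hjm, Function.iterate_add_apply]
    exact hN _ _ hj _ hy

lemma rescaledDist_le {f : Y → Y} {a : Y} {O : Set Y} {N : ℕ → ℕ}
    (hN : ∀ k, ∀ n ≥ N k, ∀ x ∈ O, dist (f^[n] x) a ≤ 1 / ((k : ℝ) + 1))
    {m : ℕ} {x y : Y} (hx : f^[m] x ∈ O) (hy : f^[m] y ∈ O) (p : ℕ × ℕ) :
    rescaledDist f a N p x y ≤ 2 ^ m * (1 / 2) ^ p.2 := by
  by_cases hp : N p.2 + m ≤ p.1
  · rw [rescaledDist_eq_zero hN hx hy hp]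
    positivity
  · calc rescaledDist f a N p x y ≤ 2 ^ p.1 * (1 / 2) ^ (p.2 + N p.2) * 1 :=
          mul_le_mul_of_nonneg_left (collapsedDist_le_one _ _ _ _) (by positivity)
      _ ≤ 2 ^ (N p.2 + m) * (1 / 2) ^ (p.2 + N p.2) * 1 := by
          gcongr
          · norm_num
          · omega
      _ = (2 * (1 / 2)) ^ N p.2 * (2 ^ m * (1 / 2) ^ p.2) := by
          rw [mul_pow]
          ring
      _ = 2 ^ m * (1 / 2) ^ p.2 := by norm_num

/-- A continuous self-map whose iterates converge pointwise to `a`, and uniformly on some open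
neighbourhood of `a`, is a contraction for a topologically equivalent metric. -/
theorem exists_contracting_metric (f : Y → Y) (hf : Continuous f) (a : Y) (O : Set Y)
    (hO : IsOpen O) (haO : a ∈ O)
    (hunif : ∀ ε > 0, ∃ N, ∀ n ≥ N, ∀ x ∈ O, dist (f^[n] x) a ≤ ε)
    (hlim : ∀ x, Tendsto (fun n => f^[n] x) atTop (nhds a)) :
    ∃ D : Y → Y → ℝ, (∀ x y, D x y = 0 ↔ x = y) ∧ (∀ x y, D x y = D y x) ∧
      (∀ x y z, D x z ≤ D x y + D y z) ∧
      (∀ x, ∀ s : Set Y, s ∈ nhds x ↔ ∃ ε > (0 : ℝ), {y | D x y < ε} ⊆ s) ∧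
      ∀ x y, D (f x) (f y) ≤ 1 / 2 * D x y := by
  choose N hN using fun k : ℕ => hunif (1 / ((k : ℝ) + 1)) (by positivity)
  have hbdd : ∀ x y, BddAbove (Set.range fun p => rescaledDist f a N p x y) := by
    intro x y
    obtain ⟨m, hx, hy⟩ := (((hlim x).eventually (hO.mem_nhds haO)).and
      ((hlim y).eventually (hO.mem_nhds haO))).exists
    refine ⟨2 ^ m * 1, ?_⟩
    rintro _ ⟨p, rfl⟩
    refine (rescaledDist_le hN hx hy p).trans ?_
    gcongr
    exact pow_le_one₀ (by norm_num) (by norm_num)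
  have hle : ∀ p x y, rescaledDist f a N p x y ≤ ⨆ p, rescaledDist f a N p x y :=
    fun p x y => le_ciSup (hbdd x y) p
  -- balls of the supremum are contained in balls of the original metric
  have hsep : ∀ x, ∀ ε > 0, ∃ δ > 0, ∀ y, (⨆ p, rescaledDist f a N p x y) < δ → dist x y < ε := by
    intro x ε hε
    obtain ⟨k, η, hη, hk⟩ : ∃ k : ℕ, ∃ η > 0, ∀ y,
        collapsedDist a (1 / ((k : ℝ) + 1)) x y < η → dist x y < ε := by
      by_cases hxa : x = a
      · subst hxa
        obtain ⟨k, hk⟩ := exists_nat_one_div_lt (half_pos hε)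
        refine ⟨k, min 1 (ε / 2), by positivity, fun y hy => ?_⟩
        by_contra! hxy
        refine hy.not_ge (min_le_min le_rfl (le_min (by linarith) ?_))
        linarith [le_max_left 0 (dist x x - 1 / ((k : ℝ) + 1)),
          le_max_right 0 (dist y x - 1 / ((k : ℝ) + 1)), dist_comm x y]
      · obtain ⟨k, hk⟩ := exists_nat_one_div_lt (dist_pos.2 hxa)
        refine ⟨k, min 1 (min ε (dist x a - 1 / ((k : ℝ) + 1))), ?_, fun y hy => ?_⟩
        · have : 0 < dist x a - 1 / ((k : ℝ) + 1) := by linarith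
          positivity
        · by_contra! hxy
          refine hy.not_ge (min_le_min le_rfl (min_le_min hxy ?_))
          linarith [le_max_right 0 (dist x a - 1 / ((k : ℝ) + 1)),
            le_max_left 0 (dist y a - 1 / ((k : ℝ) + 1))]
    refine ⟨(1 / 2) ^ (k + N k) * η, by positivity, fun y hy => hk y ?_⟩
    have := (hle (0, k) x y).trans_lt hy
    simp only [rescaledDist, pow_zero, one_mul, Function.iterate_zero, id] at this
    exact lt_of_mul_lt_mul_left this (by positivity)
  have hself : ∀ x, (⨆ p, rescaledDist f a N p x x) = 0 := fun x => by
    simp [rescaledDist, collapsedDist_self]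
  have hcont : ∀ x, ∀ ε > 0, ∀ᶠ y in nhds x, (⨆ p, rescaledDist f a N p x y) ≤ ε := by
    intro x ε hε
    obtain ⟨m, hx⟩ := ((hlim x).eventually (hO.mem_nhds haO)).exists
    have hy : ∀ᶠ y in nhds x, f^[m] y ∈ O :=
      (hf.iterate m).continuousAt.eventually (hO.mem_nhds hx)
    obtain ⟨K, hK⟩ := exists_pow_lt_of_lt_one (show 0 < ε / 2 ^ m by positivity)
      (show (1 / 2 : ℝ) < 1 by norm_num)
    have hfin : ∀ᶠ y in nhds x, ∀ p ∈ {p : ℕ × ℕ | p.2 < K ∧ p.1 < N p.2 + m},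
        rescaledDist f a N p x y ≤ ε := by
      have hF : {p : ℕ × ℕ | p.2 < K ∧ p.1 < N p.2 + m}.Finite := by
        refine ((Set.finite_Iio K).biUnion fun k _ =>
          (Set.finite_Iio (N k + m)).prod (Set.finite_singleton k)).subset ?_
        rintro ⟨n, k⟩ ⟨h1, h2⟩
        simpa using ⟨h2, h1⟩
      refine (eventually_all_finite hF).2 fun p _ => ?_
      have hc : Tendsto (fun y => 2 ^ p.1 * (1 / 2) ^ (p.2 + N p.2) *
          dist (f^[p.1] x) (f^[p.1] y)) (nhds x)
          (nhds (2 ^ p.1 * (1 / 2) ^ (p.2 + N p.2) * dist (f^[p.1] x) (f^[p.1] x))) :=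
        (continuous_const.mul (continuous_const.dist (hf.iterate p.1))).tendsto x
      rw [dist_self, mul_zero] at hc
      filter_upwards [hc.eventually (gt_mem_nhds hε)] with y hy
      exact (mul_le_mul_of_nonneg_left (collapsedDist_le_dist _ _ _ _) (by positivity)).trans hy.le
    filter_upwards [hy, hfin] with y hy hfin
    refine ciSup_le fun p => ?_
    by_cases hp : N p.2 + m ≤ p.1
    · rw [rescaledDist_eq_zero hN hx hy hp]
      exact hε.le
    by_cases hk : p.2 < K
    · exact hfin p ⟨hk, not_le.1 hp⟩
    · refine (rescaledDist_le hN hx hy p).trans ?_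
      rw [lt_div_iff₀' (by positivity)] at hK
      refine le_trans ?_ hK.le
      gcongr 2 ^ m * ?_
      exact pow_le_pow_of_le_one (by norm_num) (by norm_num) (not_lt.1 hk)
  refine ⟨fun x y => ⨆ p, rescaledDist f a N p x y, fun x y => ⟨fun h => ?_, ?_⟩, fun x y => ?_,
    fun x y z => ?_, fun x s => ⟨fun hs => ?_, ?_⟩, fun x y => ?_⟩
  · refine eq_of_forall_dist_le fun ε hε => ?_
    obtain ⟨δ, hδ, H⟩ := hsep x ε hε
    exact (H y (h.trans_lt hδ)).le
  · rintro rfl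
    exact hself x
  · simp only [rescaledDist, collapsedDist_comm]
  · refine ciSup_le fun p => le_trans ?_ (add_le_add (hle p x y) (hle p y z))
    simp only [rescaledDist, ← mul_add]
    exact mul_le_mul_of_nonneg_left (collapsedDist_triangle _ _ _ _ _) (by positivity)
  · obtain ⟨ε, hε, H⟩ := Metric.mem_nhds_iff.1 hs
    obtain ⟨δ, hδ, H'⟩ := hsep x ε hε
    exact ⟨δ, hδ, fun y hy => H (mem_ball'.2 (H' y hy))⟩
  · rintro ⟨ε, hε, H⟩
    filter_upwards [hcont x (ε / 2) (half_pos hε)] with y hy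
    exact H (hy.trans_lt (half_lt_self hε))
  · refine ciSup_le fun p => ?_
    have := hle (p.1 + 1, p.2) x y
    simp only [rescaledDist, Function.iterate_succ_apply, pow_succ] at this ⊢
    linarith

end Contraction

section Hyperspace

variable {X : Type*} [MetricSpace X] {FK : NonemptyCompacts X → NonemptyCompacts X}

lemma iterate_subset_iterate
    (hmono : ∀ B C : NonemptyCompacts X, (B : Set X) ⊆ C → (FK B : Set X) ⊆ FK C) (n : ℕ)
    {B C : NonemptyCompacts X} (h : (B : Set X) ⊆ C) : (FK^[n] B : Set X) ⊆ FK^[n] C := by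
  induction n generalizing B C with
  | zero => exact h
  | succ n ih => exact ih (hmono B C h)

/-- If every point of a compact invariant set `A` has iterates converging to `A`, then some fixed
iterate of every point of `A` is `ε`-dense in `A`. -/
lemma exists_iterate_singleton_dense (hFKcont : Continuous FK)
    (hmono : ∀ B C : NonemptyCompacts X, (B : Set X) ⊆ C → (FK B : Set X) ⊆ FK C)
    (A : NonemptyCompacts X) (hA : FK A = A)
    (hlim : ∀ x ∈ A, Tendsto (fun n => FK^[n] {x}) atTop (nhds A)) {ε : ℝ} (hε : 0 < ε) :
    ∃ M, ∀ x ∈ A, ∀ b ∈ A, infDist b (FK^[M] {x}) ≤ ε := by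
  have hcont : ∀ n, Continuous fun x : X => FK^[n] {x} := fun n =>
    (hFKcont.iterate n).comp NonemptyCompacts.continuous_singleton
  have hinv : ∀ n, ∀ x ∈ A, (FK^[n] {x} : Set X) ⊆ A := fun n x hx => by
    have := iterate_subset_iterate hmono n (B := {x}) (C := A) (by simpa using hx)
    rwa [Function.iterate_fixed hA] at this
  have : CompactSpace A := isCompact_iff_compactSpace.1 A.isCompact
  have : Nonempty A := A.nonempty.to_subtype
  obtain ⟨N, p, hp⟩ := nonempty_interior_of_iUnion_of_closed
    (f := fun N : ℕ => {x : A | ∀ n ≥ N, ∀ b ∈ A, infDist b (FK^[n] {(x : X)}) ≤ ε})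
    (fun N => by
      simp only [Set.ofPred_forall]
      refine isClosed_iInter fun n => isClosed_iInter fun _ => isClosed_iInter fun b =>
        isClosed_iInter fun _ => isClosed_le ?_ continuous_const
      exact (lipschitz_infDist_set b).continuous.comp
        ((hcont n).comp continuous_subtype_val))
    (by
      refine Set.eq_univ_of_forall fun x => Set.mem_iUnion.2 ?_
      obtain ⟨N, hN⟩ := Metric.tendsto_atTop.1 (hlim x x.2) ε hε
      refine ⟨N, fun n hn b hb => ?_⟩
      have := hN n hn
      rw [dist_comm, NonemptyCompacts.dist_eq] at this
      exact (infDist_le_hausdorffDist_of_mem hb (hausdorffEDist_ne_top_of_nonempty_of_bounded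
        A.nonempty (NonemptyCompacts.nonempty _) A.isCompact.isBounded
        (NonemptyCompacts.isCompact _).isBounded)).trans this.le)
  obtain ⟨Q, hQ, hQN⟩ := isOpen_induced_iff.1 (isOpen_interior
    (s := {x : A | ∀ n ≥ N, ∀ b ∈ A, infDist b (FK^[n] {(x : X)}) ≤ ε}))
  have hpQ : (p : X) ∈ Q := by
    rw [← hQN] at hp
    exact hp
  have hQdense : ∀ z ∈ A, z ∈ Q → ∀ n ≥ N, ∀ b ∈ A, infDist b (FK^[n] {z}) ≤ ε := by
    intro z hz hzQ
    have : (⟨z, hz⟩ : A) ∈ Subtype.val ⁻¹' Q := hzQ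
    rw [hQN] at this
    exact interior_subset this
  obtain ⟨m, hm⟩ := A.isCompact.elim_directed_cover
    (fun m : ℕ => ⋃ j ≤ m, {x : X | ((FK^[j] {x} : Set X) ∩ Q).Nonempty})
    (fun m => isOpen_biUnion fun j _ =>
      (NonemptyCompacts.isOpen_inter_nonempty_of_isOpen hQ).preimage (hcont j))
    (fun x hx => by
      obtain ⟨j, hj⟩ := ((hlim x hx).eventually
        ((NonemptyCompacts.isOpen_inter_nonempty_of_isOpen hQ).mem_nhds
          (show ((A : Set X) ∩ Q).Nonempty from ⟨p, p.2, hpQ⟩))).exists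
      exact Set.mem_iUnion.2 ⟨j, Set.mem_biUnion (le_refl j) hj⟩)
    (Monotone.directed_le fun m m' h => Set.biUnion_subset_biUnion_left fun j hj => le_trans hj h)
  refine ⟨m + N, fun x hx b hb => ?_⟩
  obtain ⟨j, hj, z, hz, hzQ⟩ := Set.mem_iUnion₂.1 (hm hx)
  refine (infDist_le_infDist_of_subset ?_ (NonemptyCompacts.nonempty _)).trans
    (hQdense z (hinv j x hx hz) hzQ (m + N - j) (by omega) b hb)
  have := iterate_subset_iterate hmono (m + N - j) (B := {z}) (C := FK^[j] {x}) (by simpa using hz)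
  rwa [← Function.iterate_add_apply, Nat.sub_add_cancel (by omega)] at this

/-- If a compact set `W` is attracted by `A`, and so are the points of `A`, then all nonempty
compact subsets of `W` are attracted uniformly. -/
lemma exists_forall_dist_iterate_le (hFKcont : Continuous FK)
    (hmono : ∀ B C : NonemptyCompacts X, (B : Set X) ⊆ C → (FK B : Set X) ⊆ FK C)
    (A : NonemptyCompacts X) (hA : FK A = A)
    (hlim : ∀ x ∈ A, Tendsto (fun n => FK^[n] {x}) atTop (nhds A))
    (W : NonemptyCompacts X) (hW : Tendsto (fun n => FK^[n] W) atTop (nhds A))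
    {ε : ℝ} (hε : 0 < ε) :
    ∃ N, ∀ n ≥ N, ∀ C : NonemptyCompacts X, (C : Set X) ⊆ W → dist (FK^[n] C) A ≤ ε := by
  obtain ⟨M, hM⟩ := exists_iterate_singleton_dense hFKcont hmono A hA hlim (half_pos hε)
  have hcont : Continuous fun x : X => FK^[M] {x} :=
    (hFKcont.iterate M).comp NonemptyCompacts.continuous_singleton
  set O : Set X := ⋃ x ∈ A, {z | dist (FK^[M] {z}) (FK^[M] {x}) < ε / 2} with hOdef
  have hO : IsOpen O := isOpen_biUnion fun x _ =>
    isOpen_lt (hcont.dist continuous_const) continuous_const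
  have hAO : (A : Set X) ⊆ O := fun x hx => Set.mem_biUnion hx (by simpa using half_pos hε)
  have hOdense : ∀ z ∈ O, ∀ b ∈ A, infDist b (FK^[M] {z}) ≤ ε := by
    intro z hz b hb
    obtain ⟨x, hx, hzx⟩ := Set.mem_iUnion₂.1 hz
    have h1 := (lipschitz_infDist_set b).dist_le_mul (FK^[M] {z}) (FK^[M] {x})
    rw [NNReal.coe_one, one_mul, Real.dist_eq] at h1
    have h2 := hM x hx b hb
    have h3 : dist (FK^[M] {z}) (FK^[M] {x}) < ε / 2 := hzx
    linarith [le_abs_self (infDist b (FK^[M] {z} : Set X) - infDist b (FK^[M] {x} : Set X))]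
  obtain ⟨N₁, hN₁⟩ := eventually_atTop.1 (hW.eventually
    ((NonemptyCompacts.isOpen_subsets_of_isOpen hO).mem_nhds hAO))
  obtain ⟨N₂, hN₂⟩ := Metric.tendsto_atTop.1 hW ε hε
  refine ⟨max N₂ (N₁ + M), fun n hn C hC => ?_⟩
  rw [NonemptyCompacts.dist_eq]
  refine hausdorffDist_le_of_infDist hε.le (fun y hy => ?_) fun b hb => ?_
  · refine (infDist_le_hausdorffDist_of_mem (iterate_subset_iterate hmono n hC hy)
      (hausdorffEDist_ne_top_of_nonempty_of_bounded
        (NonemptyCompacts.nonempty _) A.nonempty (NonemptyCompacts.isCompact _).isBounded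
        A.isCompact.isBounded)).trans ?_
    rw [← NonemptyCompacts.dist_eq]
    exact (hN₂ n (le_of_max_le_left hn)).le
  · have hn' := le_of_max_le_right hn
    obtain ⟨z, hz⟩ := (FK^[n - M] C).nonempty
    have hzO : z ∈ O := hN₁ (n - M) (by omega) (iterate_subset_iterate hmono (n - M) hC hz)
    refine (infDist_le_infDist_of_subset ?_ (NonemptyCompacts.nonempty _)).trans
      (hOdense z hzO b hb)
    have := iterate_subset_iterate hmono M (B := {z}) (C := FK^[n - M] C) (by simpa using hz)
    rwa [← Function.iterate_add_apply, Nat.add_sub_cancel' (by omega)] at this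

/-- The maximal open set attracted by `A` is forward invariant. -/
lemma image_subset_basin (hFKcont : Continuous FK)
    (hmono : ∀ B C : NonemptyCompacts X, (B : Set X) ⊆ C → (FK B : Set X) ⊆ FK C)
    (hunion : ∀ B : NonemptyCompacts X, ∀ y ∈ FK B, ∃ x ∈ B, y ∈ FK {x})
    (A : NonemptyCompacts X) {U : Set X} (hUopen : IsOpen U) (hAU : (A : Set X) ⊆ U)
    (hattr : ∀ S : NonemptyCompacts X, (S : Set X) ⊆ U →
      Tendsto (fun n => FK^[n] S) atTop (nhds A))
    (hmax : ∀ V : Set X, IsOpen V → (∀ S : NonemptyCompacts X, (S : Set X) ⊆ V →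
      Tendsto (fun n => FK^[n] S) atTop (nhds A)) → V ⊆ U)
    {S : NonemptyCompacts X} (hS : (S : Set X) ⊆ U) : (FK S : Set X) ⊆ U := by
  have hiter : ∀ n, ∀ B : NonemptyCompacts X, ∀ y ∈ FK^[n] B, ∃ x ∈ B, y ∈ FK^[n] {x} := by
    intro n
    induction n with
    | zero => exact fun B y hy => ⟨y, hy, by simp⟩
    | succ n ih =>
      intro B y hy
      rw [Function.iterate_succ_apply'] at hy
      obtain ⟨z, hz, hyz⟩ := hunion _ y hy
      obtain ⟨x, hx, hzx⟩ := ih B z hz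
      refine ⟨x, hx, ?_⟩
      rw [Function.iterate_succ_apply']
      exact hmono {z} _ (by simpa using hzx) hyz
  obtain ⟨N, hN⟩ := eventually_atTop.1 ((hattr S hS).eventually
    ((NonemptyCompacts.isOpen_subsets_of_isOpen hUopen).mem_nhds hAU))
  have hV : {x : X | (FK^[N] {x} : Set X) ⊆ U} ⊆ U := by
    refine hmax _ ((NonemptyCompacts.isOpen_subsets_of_isOpen hUopen).preimage
      ((hFKcont.iterate N).comp NonemptyCompacts.continuous_singleton)) fun T hT => ?_
    refine (tendsto_add_atTop_iff_nat N).1 ?_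
    simp only [Function.iterate_add_apply]
    refine hattr _ fun y hy => ?_
    obtain ⟨x, hx, hyx⟩ := hiter N T y hy
    exact hT hx hyx
  intro x hx
  refine hV ((iterate_subset_iterate hmono N (B := {x}) (C := FK S) (by simpa using hx)).trans ?_)
  rw [← Function.iterate_succ_apply]
  exact hN (N + 1) (by omega)

end Hyperspace

/-- **Jánoš-type theorem for strict attractors.**
Let `(X,d)` be a locally compact complete metric space and let `F : X → K(X)` be a
continuous multivalued map inducing the continuous operator `FK` on the hyperspace.
Assume `F` has a strict attractor `A` with basin of attraction `U ⊆ X` (the maximal open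
set such that every nonempty compact subset of it is attracted to `A`). Then there is a
metric `D` on `K(U) = {S ∈ K(X) | S ⊆ U}` inducing the same topology as the Hausdorff
metric, such that `FK` maps `K(U)` into itself and is a contraction on `K(U)` w.r.t. `D`. -/
theorem strict_attractor_contraction_in_basin
    {X : Type*} [MetricSpace X] [LocallyCompactSpace X] [CompleteSpace X]
    (F : X → NonemptyCompacts X) (hF : Continuous F)
    (FK : NonemptyCompacts X → NonemptyCompacts X) (hFKcont : Continuous FK)
    (hFK : ∀ B : NonemptyCompacts X, (FK B : Set X) = ⋃ x ∈ (B : Set X), (F x : Set X))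
    (A : NonemptyCompacts X)
    (U : Set X) (hUopen : IsOpen U) (hAU : (A : Set X) ⊆ U)
    (hattr : ∀ S : NonemptyCompacts X, (S : Set X) ⊆ U →
      Tendsto (fun n => dist (FK^[n] S) A) atTop (nhds 0))
    (hmax : ∀ V : Set X, IsOpen V →
      (∀ S : NonemptyCompacts X, (S : Set X) ⊆ V →
        Tendsto (fun n => dist (FK^[n] S) A) atTop (nhds 0)) → V ⊆ U) :
    ∃ D : NonemptyCompacts X → NonemptyCompacts X → ℝ,
      -- `D` is a metric on `K(U)`:
      (∀ S : NonemptyCompacts X, (S : Set X) ⊆ U → ∀ S' : NonemptyCompacts X,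
        (S' : Set X) ⊆ U → (D S S' = 0 ↔ S = S')) ∧
      (∀ S : NonemptyCompacts X, (S : Set X) ⊆ U → ∀ S' : NonemptyCompacts X,
        (S' : Set X) ⊆ U → D S S' = D S' S) ∧
      (∀ S : NonemptyCompacts X, (S : Set X) ⊆ U → ∀ S' : NonemptyCompacts X,
        (S' : Set X) ⊆ U → ∀ S'' : NonemptyCompacts X, (S'' : Set X) ⊆ U →
        D S S'' ≤ D S S' + D S' S'') ∧
      -- `D` induces on `K(U)` the same topology as the Hausdorff metric:
      (∀ S : NonemptyCompacts X, (S : Set X) ⊆ U →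
        ∀ s : Set (NonemptyCompacts X),
          s ∈ nhdsWithin S {C : NonemptyCompacts X | (C : Set X) ⊆ U} ↔
          ∃ ε > (0 : ℝ), {C : NonemptyCompacts X | (C : Set X) ⊆ U ∧ D S C < ε} ⊆ s) ∧
      -- `FK` restricted to `K(U)` is a `D`-contraction:
      (∀ S : NonemptyCompacts X, (S : Set X) ⊆ U → (FK S : Set X) ⊆ U) ∧
      ∃ c : ℝ, 0 ≤ c ∧ c < 1 ∧
        ∀ S : NonemptyCompacts X, (S : Set X) ⊆ U → ∀ S' : NonemptyCompacts X,
          (S' : Set X) ⊆ U → D (FK S) (FK S') ≤ c * D S S' := by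
  classical
  have hattr' : ∀ S : NonemptyCompacts X, (S : Set X) ⊆ U →
      Tendsto (fun n => FK^[n] S) atTop (nhds A) := fun S hS =>
    tendsto_iff_dist_tendsto_zero.2 (hattr S hS)
  have hmono : ∀ B C : NonemptyCompacts X, (B : Set X) ⊆ C → (FK B : Set X) ⊆ FK C := by
    intro B C h
    rw [hFK, hFK]
    exact Set.biUnion_subset_biUnion_left h
  have hunion : ∀ B : NonemptyCompacts X, ∀ y ∈ FK B, ∃ x ∈ B, y ∈ FK {x} := by
    intro B y hy
    rw [← SetLike.mem_coe, hFK] at hy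
    obtain ⟨x, hx, hyx⟩ := Set.mem_iUnion₂.1 hy
    refine ⟨x, hx, ?_⟩
    rw [← SetLike.mem_coe, hFK]
    simpa using hyx
  have hmaps : ∀ S : NonemptyCompacts X, (S : Set X) ⊆ U → (FK S : Set X) ⊆ U := fun S hS =>
    image_subset_basin hFKcont hmono hunion A hUopen hAU hattr'
      (fun V hV h => hmax V hV fun S hS => tendsto_iff_dist_tendsto_zero.1 (h S hS)) hS
  have hA : FK A = A := isFixedPt_of_tendsto_iterate (hattr' A hAU) hFKcont.continuousAt
  have hlim : ∀ x ∈ A, Tendsto (fun n => FK^[n] {x}) atTop (nhds A) := fun x hx =>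
    hattr' {x} (by simpa using hAU hx)
  obtain ⟨W, hW, hAW, hWU⟩ := exists_compact_between A.isCompact hUopen hAU
  obtain ⟨W, rfl⟩ : ∃ W' : NonemptyCompacts X, (W' : Set X) = W :=
    ⟨⟨⟨W, hW⟩, A.nonempty.mono (hAW.trans interior_subset)⟩, rfl⟩
  let f : {S : NonemptyCompacts X // (S : Set X) ⊆ U} →
      {S : NonemptyCompacts X // (S : Set X) ⊆ U} :=
    fun S => ⟨FK S, hmaps S S.2⟩
  have hf : Continuous f := (hFKcont.comp continuous_subtype_val).subtype_mk _
  have hfn : ∀ n S, ((f^[n] S : {S : NonemptyCompacts X // (S : Set X) ⊆ U}) :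
      NonemptyCompacts X) = FK^[n] S := fun n S =>
    Function.Semiconj.iterate_right (f := Subtype.val) (ga := f) (gb := FK) (fun _ => rfl) n S
  obtain ⟨D, h0, hsymm, htri, hnhds, hcontr⟩ := exists_contracting_metric f hf ⟨A, hAU⟩
    {S | (S : Set X) ⊆ interior (W : Set X)}
    ((NonemptyCompacts.isOpen_subsets_of_isOpen isOpen_interior).preimage continuous_subtype_val)
    hAW
    (fun ε hε => by
      obtain ⟨N, hN⟩ := exists_forall_dist_iterate_le hFKcont hmono A hA hlim W (hattr' W hWU) hε
      refine ⟨N, fun n hn S hS => ?_⟩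
      rw [Subtype.dist_eq, hfn]
      exact hN n hn S (hS.trans interior_subset))
    (fun S => by
      rw [tendsto_subtype_rng]
      simp only [hfn]
      exact hattr' S S.2)
  refine ⟨fun S S' => if h : (S : Set X) ⊆ U ∧ (S' : Set X) ⊆ U then D ⟨S, h.1⟩ ⟨S', h.2⟩ else 0,
    fun S hS S' hS' => ?_, fun S hS S' hS' => ?_, fun S hS S' hS' S'' hS'' => ?_,
    fun S hS s => ?_, hmaps, 1 / 2, by norm_num, by norm_num, fun S hS S' hS' => ?_⟩
  · simpa [hS, hS'] using h0 ⟨S, hS⟩ ⟨S', hS'⟩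
  · simpa [hS, hS'] using hsymm ⟨S, hS⟩ ⟨S', hS'⟩
  · simpa [hS, hS', hS''] using htri ⟨S, hS⟩ ⟨S', hS'⟩ ⟨S'', hS''⟩
  · refine preimage_coe_mem_nhds_subtype.symm.trans ((hnhds ⟨S, hS⟩ _).trans ?_)
    refine exists_congr fun ε => and_congr_right fun _ => ⟨fun h C hC => ?_, fun h C hC => ?_⟩
    · have hC' : D ⟨S, hS⟩ ⟨C, hC.1⟩ < ε := by simpa [hS, hC.1] using hC.2
      exact @h ⟨C, hC.1⟩ hC'
    · have hC' : D ⟨S, hS⟩ ⟨C, C.2⟩ < ε := hC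
      have hCU : (C.1 : Set X) ⊆ U := C.2
      exact h ⟨hCU, by simpa [hS, hCU] using hC'⟩
  · simpa [hS, hS', hmaps S hS, hmaps S' hS'] using hcontr ⟨S, hS⟩ ⟨S', hS'⟩
end
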